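/- Let Ω be a finite state space, let μ be a fully supported probability distribution on Ω, let δ ∈ (0,1), and let P be a Markov transition kernel on Ω that is reversible with respect to μ and exhibits entropy decay with rate δ, i.e., for every function f: Ω → ℝ_{≥0}, Ent_μ[Pf] ≤ (1−δ)·Ent_μ[f]. Then for every x_0 ∈ Ω and every integer T ≥ 0, d_TV(δ_{x_0} P^T, μ) ≤ sqrt(exp(−δ·T)·log(1/μ(x_0))). -/

import Mathlib

open Finset

/-- `P` is a Markov transition kernel on the finite state space `Ω`. -/
def IsKernel {Ω : Type} [Fintype Ω] (P : Ω → Ω → ℝ) : Prop :=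
  ∀ x, (∀ y, 0 ≤ P x y) ∧ ∑ y : Ω, P x y = 1

/-- The action of a kernel on a distribution: `(ν P)(y) = ∑_x ν(x)·P(x,y)`. -/
def kApply {Ω : Type} [Fintype Ω] (ν : Ω → ℝ) (P : Ω → Ω → ℝ) : Ω → ℝ :=
  fun y => ∑ x : Ω, ν x * P x y

/-- The action of a kernel on a function: `(Pf)(x) = ∑_y P(x,y)·f(y)`. -/
def kFun {Ω : Type} [Fintype Ω] (P : Ω → Ω → ℝ) (f : Ω → ℝ) : Ω → ℝ :=
  fun x => ∑ y : Ω, P x y * f y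

/-- The entropy functional `Ent_μ[f] = E_μ[f log f] − E_μ[f]·log E_μ[f]`
(with `log 0 = 0`, so the convention `0·log 0 = 0` holds). -/
noncomputable def entFun {Ω : Type} [Fintype Ω] (μ : Ω → ℝ) (f : Ω → ℝ) : ℝ :=
  (∑ x : Ω, μ x * (f x * Real.log (f x))) -
    (∑ x : Ω, μ x * f x) * Real.log (∑ x : Ω, μ x * f x)

/-- Total variation distance between two distributions on a finite state space. -/
noncomputable def dTVfun {Ω : Type} [Fintype Ω] (μ ν : Ω → ℝ) : ℝ :=
  (1 / 2) * ∑ x : Ω, |μ x - ν x|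

lemma aux_pt (t : ℝ) (ht : 0 ≤ t) :
    (Real.sqrt t - 1) ^ 2 ≤ t * Real.log t - t + 1 := by
  rcases ht.eq_or_lt with h | h
  · subst h; simp
  · have hs : 0 < Real.sqrt t := Real.sqrt_pos.2 h
    have hq : Real.sqrt t ^ 2 = t := Real.sq_sqrt ht
    have h1 := Real.one_sub_inv_le_log_of_pos hs
    have h2 : Real.log t = 2 * Real.log (Real.sqrt t) := by
      rw [Real.log_sqrt ht]; ring
    have h3 : t * (1 - (Real.sqrt t)⁻¹) ≤ t * Real.log (Real.sqrt t) :=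
      mul_le_mul_of_nonneg_left h1 ht
    have h4 : t * (Real.sqrt t)⁻¹ = Real.sqrt t := by
      field_simp; exact hq.symm
    rw [h2]
    nlinarith

lemma aux_pinsker {Ω : Type} [Fintype Ω] (μ : Ω → ℝ) (hpos : ∀ x, 0 < μ x)
    (hsum : ∑ x : Ω, μ x = 1) (f : Ω → ℝ) (hf : ∀ x, 0 ≤ f x)
    (hf1 : ∑ x : Ω, μ x * f x = 1) :
    (dTVfun (fun x => μ x * f x) μ) ^ 2 ≤ entFun μ f := by
  have hA : ∑ x, μ x * (Real.sqrt (f x) - 1) ^ 2 ≤ entFun μ f := by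
    have : entFun μ f = ∑ x, μ x * (f x * Real.log (f x) - f x + 1) := by
      simp only [entFun, hf1, mul_add, mul_sub, sum_add_distrib, sum_sub_distrib, mul_one, hsum]
      simp
    rw [this]
    exact sum_le_sum fun x _ => mul_le_mul_of_nonneg_left (aux_pt _ (hf x)) (hpos x).le
  have hB : ∑ x, μ x * (Real.sqrt (f x) + 1) ^ 2 ≤ 4 := by
    have : ∑ x, μ x * (2 * f x + 2) = 4 := by
      have : ∀ x, μ x * (2 * f x + 2) = 2 * (μ x * f x) + 2 * μ x := fun x => by ring
      simp only [this, sum_add_distrib, ← mul_sum, hf1, hsum]; norm_num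
    rw [← this]
    refine sum_le_sum fun x _ => mul_le_mul_of_nonneg_left ?_ (hpos x).le
    have := Real.sq_sqrt (hf x)
    nlinarith [sq_nonneg (Real.sqrt (f x) - 1)]
  have hC : (∑ x, |μ x * f x - μ x|) ^ 2 ≤
      (∑ x, μ x * (Real.sqrt (f x) - 1) ^ 2) * ∑ x, μ x * (Real.sqrt (f x) + 1) ^ 2 := by
    refine sum_sq_le_sum_mul_sum_of_sq_eq_mul _ (fun x _ => ?_) (fun x _ => ?_) (fun x _ => ?_)
    · exact mul_nonneg (hpos x).le (sq_nonneg _)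
    · exact mul_nonneg (hpos x).le (sq_nonneg _)
    · rw [sq_abs]
      have := Real.sq_sqrt (hf x)
      have h2 : f x - 1 = (Real.sqrt (f x) - 1) * (Real.sqrt (f x) + 1) := by linarith
      calc (μ x * f x - μ x) ^ 2 = μ x ^ 2 * (f x - 1) ^ 2 := by ring
        _ = _ := by rw [h2]; ring
  have hA0 : 0 ≤ ∑ x, μ x * (Real.sqrt (f x) - 1) ^ 2 :=
    sum_nonneg fun x _ => mul_nonneg (hpos x).le (sq_nonneg _)
  have hD := mul_le_mul_of_nonneg_left hB hA0
  simp only [dTVfun]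
  rw [mul_pow]
  linarith

/-- **Entropy decay implies total variation convergence.** If `P` is reversible w.r.t. the
fully supported distribution `μ` and exhibits entropy decay with rate `δ`, then
`d_TV(δ_{x₀} Pᵀ, μ) ≤ sqrt(exp(−δT)·log(1/μ(x₀)))` for every starting state `x₀` and `T ≥ 0`. -/
theorem entropy_decay_to_tv {Ω : Type} [Fintype Ω] [DecidableEq Ω] [Nonempty Ω]
    (μ : Ω → ℝ) (hpos : ∀ x, 0 < μ x) (hsum : ∑ x : Ω, μ x = 1)
    (δ : ℝ) (hδ : δ ∈ Set.Ioo (0 : ℝ) 1)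
    (P : Ω → Ω → ℝ) (hP : IsKernel P)
    (hrev : ∀ x y, μ x * P x y = μ y * P y x)
    (hdecay : ∀ f : Ω → ℝ, (∀ x, 0 ≤ f x) →
      entFun μ (kFun P f) ≤ (1 - δ) * entFun μ f) :
    ∀ (x₀ : Ω) (T : ℕ),
      dTVfun ((fun ρ => kApply ρ P)^[T] (fun x => if x = x₀ then 1 else 0)) μ ≤
        Real.sqrt (Real.exp (-δ * (T : ℝ)) * Real.log (1 / μ x₀)) := by
  intro x₀ T
  have key : ∃ f : Ω → ℝ, (∀ x, 0 ≤ f x) ∧ (∑ x, μ x * f x = 1) ∧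
      ((fun ρ => kApply ρ P)^[T] (fun x => if x = x₀ then 1 else 0)) = (fun x => μ x * f x) ∧
      entFun μ f ≤ (1 - δ) ^ T * Real.log (1 / μ x₀) := by
    induction T with
    | zero =>
      have h0 : (μ x₀) ≠ 0 := (hpos x₀).ne'
      refine ⟨fun x => if x = x₀ then 1 / μ x₀ else 0, ?_, ?_, ?_, ?_⟩
      · intro x
        have := hpos x₀
        dsimp only
        split_ifs <;> positivity
      · simp [h0]
      · funext x
        by_cases h : x = x₀
        · subst h; simp [h0]
        · simp [h]
      · simp [entFun, h0]
    | succ T ih =>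
      obtain ⟨f, hf, hf1, hfe, hfd⟩ := ih
      have hstep : kApply (fun x => μ x * f x) P = fun x => μ x * kFun P f x := by
        funext y
        simp only [kApply, kFun, mul_sum]
        refine sum_congr rfl fun x _ => ?_
        linear_combination f x * hrev x y
      refine ⟨kFun P f, ?_, ?_, ?_, ?_⟩
      · exact fun x => sum_nonneg fun y _ => mul_nonneg ((hP x).1 y) (hf y)
      · have : ∑ y, kApply (fun x => μ x * f x) P y = 1 := by
          simp only [kApply]
          rw [sum_comm]
          simp only [← mul_sum, (hP _).2, mul_one, hf1]
        rw [hstep] at this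
        exact this
      · rw [Function.iterate_succ_apply', hfe]
        exact hstep
      · refine (hdecay f hf).trans ?_
        rw [pow_succ']
        have := mul_le_mul_of_nonneg_left hfd (sub_nonneg.2 hδ.2.le)
        linarith
  obtain ⟨f, hf, hf1, hfe, hfd⟩ := key
  rw [hfe]
  apply Real.le_sqrt_of_sq_le
  refine (aux_pinsker μ hpos hsum f hf hf1).trans (hfd.trans ?_)
  have hle : μ x₀ ≤ 1 := by
    rw [← hsum]
    exact single_le_sum (f := μ) (fun x _ => (hpos x).le) (mem_univ x₀)
  have hlog : 0 ≤ Real.log (1 / μ x₀) :=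
    Real.log_nonneg ((one_le_div (hpos x₀)).2 hle)
  refine mul_le_mul_of_nonneg_right ?_ hlog
  have h1 : 1 - δ ≤ Real.exp (-δ) := Real.one_sub_le_exp_neg δ
  calc (1 - δ) ^ T ≤ Real.exp (-δ) ^ T := pow_le_pow_left₀ (sub_nonneg.2 hδ.2.le) h1 T
    _ = Real.exp (-δ * T) := by rw [← Real.exp_nat_mul]; ring_nf
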